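/- Let μ > 0 and c > 0, and let X be a random variable with the exponential distribution of rate μ (density μe^{−μx} on [0,∞)). Define B = X/2 − c/(2X). Then for every real y, P(B ≤ y) = 1 − exp(−μ(y + √(y² + c))). -/

import Mathlib

open MeasureTheory ProbabilityTheory Real Set

/-- For `x > 0`, the inequality `x / 2 - c / (2 * x) ≤ y` says that `x` does not exceed the
positive root of `x ^ 2 - 2 * y * x - c`. -/
theorem half_sub_div_le_iff {c x : ℝ} (hc : 0 < c) (hx : 0 < x) (y : ℝ) :
    x / 2 - c / (2 * x) ≤ y ↔ x ≤ y + √(y ^ 2 + c) := by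
  have hfac : x / 2 - c / (2 * x) - y = ((x - y) ^ 2 - (y ^ 2 + c)) / (2 * x) := by
    field_simp
    ring
  have hlow : -√(y ^ 2 + c) < -y := neg_lt_neg (lt_sqrt_of_sq_lt (by linarith))
  rw [← sub_nonpos, hfac, div_le_iff₀ (by positivity), zero_mul, sub_nonpos,
    sq_le (by positivity)]
  constructor
  · rintro ⟨-, h⟩
    linarith
  · intro h
    constructor <;> linarith

/-- The exponential distribution has no mass on the nonpositive half-line. -/
theorem ae_pos_expMeasure {r : ℝ} (hr : 0 < r) : ∀ᵐ x ∂expMeasure r, 0 < x := by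
  have := isProbabilityMeasure_expMeasure hr
  have h := cdf_expMeasure_eq hr 0
  rw [cdf_eq_real] at h
  have h0 : expMeasure r (Iic 0) = 0 := by
    rw [← measureReal_eq_zero_iff]
    simpa using h
  rw [ae_iff]
  simpa [Iic] using h0

/-- Appendix A: the distance `B = X/2 - c/(2X)` from the top-to-bottom handover point to
the bottom-side base station (with `X` exponential of rate `μ`) has CDF
`P(B ≤ y) = 1 - exp (-μ (y + √(y² + c)))` for every real `y`. -/
theorem handover_distance_bottom_cdf
    (mu c : ℝ) (hmu : 0 < mu) (hc : 0 < c)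
    (Ω : Type*) [MeasurableSpace Ω] (P : Measure Ω) [IsProbabilityMeasure P]
    (X : Ω → ℝ) (hX : Measurable X)
    (hXlaw : P.map X = ProbabilityTheory.expMeasure mu) :
    ∀ y : ℝ,
      (P {ω | X ω / 2 - c / (2 * X ω) ≤ y}).toReal
        = 1 - Real.exp (-mu * (y + Real.sqrt (y ^ 2 + c))) := by
  intro y
  have := isProbabilityMeasure_expMeasure hmu
  have hpos : ∀ᵐ ω ∂P, 0 < X ω :=
    ae_of_ae_map hX.aemeasurable (hXlaw ▸ ae_pos_expMeasure hmu)
  have hset : P {ω | X ω / 2 - c / (2 * X ω) ≤ y} = P (X ⁻¹' Iic (y + √(y ^ 2 + c))) := by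
    apply measure_congr
    filter_upwards [hpos] with ω hω
    exact propext (half_sub_div_le_iff hc hω y)
  have hroot : 0 ≤ y + √(y ^ 2 + c) := by
    linarith [neg_sqrt_lt_of_sq_lt (lt_add_of_pos_right (y ^ 2) hc)]
  rw [hset, ← Measure.map_apply hX measurableSet_Iic, hXlaw, ← measureReal_def, ← cdf_eq_real,
    cdf_expMeasure_eq hmu, if_pos hroot, neg_mul]
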